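/- Let r ≥ 2 and s ≥ 2 be integers and let (𝓗_n) be a sequence of nonempty s-uniform hypergraphs that is non-clustered and robustly non-r-colourable. Then there exist constants C and α > 0 such that for all sufficiently large n and every p ∈ [C·p_{𝓗_n}, 1], the probability that 𝓗_n[V(𝓗_n)_p] is r-colourable is at most exp(−α·p·v(𝓗_n)). -/

import Mathlib

open Filter
open scoped Classical

open Classical in
/-- The probability that the binomial random subset of the finite set `X`,
in which each element is retained independently with probability `p`,
satisfies the predicate `P`. -/
noncomputable def probSub {α : Type*} (X : Finset α) (p : ℝ) (P : Finset α → Prop) : ℝ :=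
  ∑ S ∈ X.powerset, if P S then p ^ S.card * (1 - p) ^ (X.card - S.card) else 0

/-- The degree of the vertex set `T` in the hypergraph `H`: the number of edges
of `H` containing `T`. -/
noncomputable def degH {V : Type*} (H : Finset (Finset V)) (T : Finset V) : ℕ :=
  (H.filter fun e => T ⊆ e).card

/-- `Δ_t(H)`: the maximum degree of a `t`-element vertex set in `H`. -/
noncomputable def maxDeg {V : Type*} [Fintype V] (H : Finset (Finset V)) (t : ℕ) : ℕ :=
  (Finset.univ.filter fun T : Finset V => T.card = t).sup (degH H)

/-- `p_𝓗 := (v(𝓗)/e(𝓗))^{1/(s−1)}`. -/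
noncomputable def pH {V : Type*} [Fintype V] (s : ℕ) (H : Finset (Finset V)) : ℝ :=
  ((Fintype.card V : ℝ) / (H.card : ℝ)) ^ (1 / ((s : ℝ) - 1))

/-- A sequence of `s`-uniform hypergraphs is non-clustered:
`Δ₁(𝓗_n) = O(e(𝓗_n)/v(𝓗_n))` and, for each `t ∈ {2,…,s−1}`,
`Δ_t(𝓗_n) = o(p_{𝓗_n}^{t−1}·e(𝓗_n)/v(𝓗_n))`. -/
def NonClustered (s : ℕ) (V : ℕ → Type) [∀ n, Fintype (V n)]
    (H : ∀ n, Finset (Finset (V n))) : Prop :=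
  (∃ C : ℝ, ∀ n, (maxDeg (H n) 1 : ℝ) ≤ C * ((H n).card : ℝ) / (Fintype.card (V n) : ℝ)) ∧
  ∀ t : ℕ, 2 ≤ t → t ≤ s - 1 → ∀ ε : ℝ, 0 < ε →
    ∀ᶠ n in atTop, (maxDeg (H n) t : ℝ) ≤
      ε * pH s (H n) ^ (t - 1) * ((H n).card : ℝ) / (Fintype.card (V n) : ℝ)


/-- `𝓗[Z]` is `r`-colourable: the vertices can be coloured with `r` colours so
that no edge of `𝓗` induced on `Z` is monochromatic. -/
def RColourable {V : Type*} (r : ℕ) (H : Finset (Finset V)) (Z : Finset V) : Prop :=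
  ∃ c : V → Fin r, ∀ e ∈ H, e ⊆ Z → ¬ ∃ i : Fin r, ∀ v ∈ e, c v = i

/-- `(𝓗_n)` is robustly non-`r`-colourable: there is `δ > 0` such that, for all
sufficiently large `n`, every `r`-colouring of `V(𝓗_n)` makes at least
`δ·e(𝓗_n)` edges monochromatic. -/
def RobustlyNonColourable (r : ℕ) (V : ℕ → Type) [∀ n, Fintype (V n)]
    (H : ∀ n, Finset (Finset (V n))) : Prop :=
  ∃ δ : ℝ, 0 < δ ∧ ∀ᶠ n in atTop, ∀ c : V n → Fin r,
    δ * ((H n).card : ℝ) ≤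
      (Nat.card {e : Finset (V n) // e ∈ H n ∧ ∃ i : Fin r, ∀ v ∈ e, c v = i} : ℝ)

/-- The weighted degree of the vertex set `T`: the total weight of the sets containing `T`. -/
noncomputable def wdeg {V : Type*} [Fintype V] (w : Finset V → ℝ) (T : Finset V) : ℝ :=
  ∑ e with T ⊆ e, w e

/-- `w` is a weighted `k`-uniform hypergraph on the vertex set `A` in which every nonempty set `T`
has weighted degree at most `K * q ^ (|T| - 1)`. -/
structure BoundedWeight {V : Type*} [Fintype V] (k : ℕ) (A : Finset V) (K q : ℝ)
    (w : Finset V → ℝ) : Prop where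
  nonneg : ∀ e, 0 ≤ w e
  card_eq : ∀ e, w e ≠ 0 → e.card = k
  subset : ∀ e, w e ≠ 0 → e ⊆ A
  wdeg_le : ∀ T : Finset V, T.Nonempty → wdeg w T ≤ K * q ^ (T.card - 1)

/-- No nonempty subset of `f` has reached the degree threshold in `u`. -/
def Unsaturated {V : Type*} [Fintype V] (K q : ℝ) (u : Finset V → ℝ) (f : Finset V) : Prop :=
  ∀ T ⊆ f, T.Nonempty → wdeg u T < K * q ^ (T.card - 1)

/-- The part of the link of `v` in `w` carried by sets that are unsaturated in `u`. -/
noncomputable def freeLink {V : Type*} [Fintype V] (K q : ℝ) (w u : Finset V → ℝ) (v : V)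
    (f : Finset V) : ℝ :=
  if v ∉ f ∧ Unsaturated K q u f then w (insert v f) else 0

/-- The total weight of `freeLink`. -/
noncomputable def gain {V : Type*} [Fintype V] (K q : ℝ) (w u : Finset V → ℝ) (v : V) : ℝ :=
  ∑ f, freeLink K q w u v f

/-- Add the rescaled free link of `v` to `u` if `v` lies in `X` and its gain is at least `β`. -/
noncomputable def greedyStep {V : Type*} [Fintype V] (K q β : ℝ) (w : Finset V → ℝ)
    (X : Finset V) (u : Finset V → ℝ) (v : V) : Finset V → ℝ :=
  if v ∈ X ∧ β ≤ gain K q w u v then fun f => u f + freeLink K q w u v f / q else u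

/-- The weight obtained by greedily processing the vertices of a list. -/
noncomputable def greedyWeight {V : Type*} [Fintype V] (K q β : ℝ) (w : Finset V → ℝ)
    (X : Finset V) : List V → (Finset V → ℝ) → (Finset V → ℝ)
  | [], u => u
  | v :: l, u => greedyWeight K q β w X l (greedyStep K q β w X u v)

/-- The set of vertices whose link is used by `greedyWeight`. -/
noncomputable def greedySet {V : Type*} [Fintype V] (K q β : ℝ) (w : Finset V → ℝ)
    (X : Finset V) : List V → (Finset V → ℝ) → Finset V
  | [], _ => ∅
  | v :: l, u =>
    if v ∈ X ∧ β ≤ gain K q w u v then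
      insert v (greedySet K q β w X l (greedyStep K q β w X u v))
    else greedySet K q β w X l (greedyStep K q β w X u v)

section Greedy

variable {V : Type*} [Fintype V] {k : ℕ} {A X Y : Finset V} {K q β : ℝ} {w u : Finset V → ℝ}

lemma wdeg_mono {u u' : Finset V → ℝ} (h : ∀ f, u f ≤ u' f) (T : Finset V) :
    wdeg u T ≤ wdeg u' T :=
  Finset.sum_le_sum fun f _ => h f

lemma Unsaturated.anti {u u' : Finset V → ℝ} (h : ∀ f, u f ≤ u' f) {f : Finset V}
    (hf : Unsaturated K q u' f) : Unsaturated K q u f :=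
  fun T hT hne => (wdeg_mono h T).trans_lt (hf T hT hne)

lemma freeLink_nonneg (hw : ∀ e, 0 ≤ w e) (v : V) (f : Finset V) :
    0 ≤ freeLink K q w u v f := by
  unfold freeLink
  split_ifs
  exacts [hw _, le_rfl]

lemma gain_anti (hw : ∀ e, 0 ≤ w e) {u u' : Finset V → ℝ} (h : ∀ f, u f ≤ u' f) (v : V) :
    gain K q w u' v ≤ gain K q w u v := by
  refine Finset.sum_le_sum fun f _ => ?_
  by_cases hf : v ∉ f ∧ Unsaturated K q u' f
  · simp [freeLink, hf.1, hf.2, hf.2.anti h]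
  · rw [freeLink, if_neg hf]
    exact freeLink_nonneg hw v f

lemma le_greedyStep (hw : ∀ e, 0 ≤ w e) (hq : 0 < q) (v : V) (f : Finset V) :
    u f ≤ greedyStep K q β w X u v f := by
  unfold greedyStep
  split_ifs
  · exact le_add_of_nonneg_right (div_nonneg (freeLink_nonneg hw v f) hq.le)
  · exact le_rfl

lemma le_greedyWeight (hw : ∀ e, 0 ≤ w e) (hq : 0 < q) (l : List V) (f : Finset V) :
    u f ≤ greedyWeight K q β w X l u f := by
  induction l generalizing u with
  | nil => exact le_rfl
  | cons v l ih => exact (le_greedyStep hw hq v f).trans ih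

lemma greedySet_subset (l : List V) : greedySet K q β w X l u ⊆ X := by
  induction l generalizing u with
  | nil => exact Finset.empty_subset _
  | cons v l ih =>
    rw [greedySet]
    split_ifs with h
    · exact Finset.insert_subset h.1 ih
    · exact ih

/-- The greedy weight is determined by the set of chosen vertices. -/
lemma greedyWeight_eq_of_subset (l : List V) (h : greedySet K q β w X l u ⊆ Y) (hY : Y ⊆ X) :
    greedyWeight K q β w Y l u = greedyWeight K q β w X l u := by
  induction l generalizing u with
  | nil => rfl
  | cons v l ih =>
    rw [greedySet] at h
    have hstep : greedyStep K q β w Y u v = greedyStep K q β w X u v := by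
      unfold greedyStep
      by_cases hv : v ∈ X ∧ β ≤ gain K q w u v
      · rw [if_pos hv] at h
        rw [if_pos hv, if_pos ⟨h (Finset.mem_insert_self _ _), hv.2⟩]
      · rw [if_neg hv, if_neg fun hv' => hv ⟨hY hv'.1, hv'.2⟩]
    rw [greedyWeight, greedyWeight, hstep]
    refine ih ?_
    split_ifs at h
    exacts [(Finset.subset_insert _ _).trans h, h]

lemma mem_greedySet_or_gain_lt (hw : ∀ e, 0 ≤ w e) (hq : 0 < q) (l : List V) {v : V}
    (hv : v ∈ l) (hX : v ∈ X) :
    v ∈ greedySet K q β w X l u ∨ gain K q w (greedyWeight K q β w X l u) v < β := by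
  induction l generalizing u with
  | nil => simp at hv
  | cons x l ih =>
    rw [greedySet, greedyWeight]
    rcases List.mem_cons.1 hv with rfl | hv
    · by_cases h : β ≤ gain K q w u v
      · exact Or.inl (by simp [hX, h])
      · refine Or.inr ((gain_anti hw (fun f => ?_) v).trans_lt (not_le.1 h))
        exact (le_greedyStep hw hq v f).trans (le_greedyWeight hw hq l f)
    · refine (ih hv).imp_left fun h => ?_
      split_ifs
      exacts [Finset.mem_insert_of_mem h, h]

lemma card_greedySet_le (hq : 0 < q) (hβ : 0 < β) (l : List V) :
    ∑ f, u f + (greedySet K q β w X l u).card * (β / q) ≤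
      ∑ f, greedyWeight K q β w X l u f := by
  induction l generalizing u with
  | nil => simp [greedySet, greedyWeight]
  | cons v l ih =>
    refine le_trans ?_ (ih (u := greedyStep K q β w X u v))
    rw [greedySet]
    by_cases hv : v ∈ X ∧ β ≤ gain K q w u v
    · rw [if_pos hv]
      have h1 : ∑ f, u f + β / q ≤ ∑ f, greedyStep K q β w X u v f := by
        simp only [greedyStep, if_pos hv, Finset.sum_add_distrib, ← Finset.sum_div]
        gcongr
        exact hv.2
      have h2 : ((insert v (greedySet K q β w X l (greedyStep K q β w X u v))).card : ℝ) ≤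
          (greedySet K q β w X l (greedyStep K q β w X u v)).card + 1 := by
        exact_mod_cast Finset.card_insert_le _ _
      have h3 := mul_le_mul_of_nonneg_right h2 (div_pos hβ hq).le
      linarith
    · rw [if_neg hv]
      simp only [greedyStep, if_neg hv, le_refl]

lemma wdeg_freeLink_le (hK : 0 ≤ K) (hq : 0 < q) (hw : BoundedWeight k A K q w) (v : V)
    (T : Finset V) : wdeg (freeLink K q w u v) T ≤ K * q ^ T.card := by
  by_cases hvT : v ∈ T
  · have h0 : wdeg (freeLink K q w u v) T = 0 := by
      refine Finset.sum_eq_zero fun f hf => if_neg fun h => h.1 ?_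
      exact (Finset.mem_filter.1 hf).2 hvT
    rw [h0]
    positivity
  · have h := hw.wdeg_le (insert v T) (Finset.insert_nonempty _ _)
    rw [Finset.card_insert_of_notMem hvT, Nat.add_sub_cancel] at h
    refine le_trans ?_ h
    calc wdeg (freeLink K q w u v) T
        ≤ ∑ f with T ⊆ f ∧ v ∉ f, w (insert v f) := by
          unfold wdeg freeLink
          rw [Finset.sum_filter, Finset.sum_filter]
          refine Finset.sum_le_sum fun f _ => ?_
          have := hw.nonneg (insert v f)
          split_ifs <;> simp_all
      _ = ∑ e ∈ (Finset.univ.filter fun f => T ⊆ f ∧ v ∉ f).image (insert v), w e := by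
          rw [Finset.sum_image]
          intro f hf g hg hfg
          simp only [Finset.coe_filter, Finset.mem_univ, true_and, Set.mem_ofPred_eq] at hf hg
          rw [← Finset.erase_insert hf.2, ← Finset.erase_insert hg.2]
          exact congrArg (fun s => Finset.erase s v) hfg
      _ ≤ wdeg w (insert v T) := by
          refine Finset.sum_le_sum_of_subset_of_nonneg ?_ fun e _ _ => hw.nonneg e
          intro e he
          obtain ⟨f, hf, rfl⟩ := Finset.mem_image.1 he
          simp only [Finset.mem_filter, Finset.mem_univ, true_and] at hf ⊢
          exact Finset.insert_subset_insert v hf.1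

lemma BoundedWeight.greedyStep (hK : 0 ≤ K) (hq : 0 < q) (hw : BoundedWeight (k + 1) A K q w)
    (hu : BoundedWeight k A (2 * K) q u) (v : V) :
    BoundedWeight k A (2 * K) q (greedyStep K q β w X u v) := by
  by_cases hv : v ∈ X ∧ β ≤ gain K q w u v
  swap
  · rwa [_root_.greedyStep, if_neg hv]
  have hsupp : ∀ f, u f + freeLink K q w u v f / q ≠ 0 →
      u f ≠ 0 ∨ (v ∉ f ∧ w (insert v f) ≠ 0) := by
    intro f hf
    by_contra! h
    refine hf ?_
    rw [h.1, freeLink]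
    split_ifs with h'
    · simp [h.2 h'.1]
    · simp
  rw [_root_.greedyStep, if_pos hv]
  refine ⟨fun f => ?_, fun f hf => ?_, fun f hf => ?_, fun T hT => ?_⟩
  · exact add_nonneg (hu.nonneg f) (div_nonneg (freeLink_nonneg hw.nonneg v f) hq.le)
  · rcases hsupp f hf with h | ⟨h1, h2⟩
    · exact hu.card_eq f h
    · have := hw.card_eq _ h2
      rw [Finset.card_insert_of_notMem h1] at this
      omega
  · rcases hsupp f hf with h | ⟨-, h⟩
    · exact hu.subset f h
    · exact (Finset.subset_insert _ _).trans (hw.subset _ h)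
  · have hsum : wdeg (fun f => u f + freeLink K q w u v f / q) T =
        wdeg u T + wdeg (freeLink K q w u v) T / q := by
      simp only [wdeg, Finset.sum_add_distrib, Finset.sum_div]
    rw [hsum]
    by_cases hsat : wdeg u T < K * q ^ (T.card - 1)
    · have h1 : wdeg (freeLink K q w u v) T / q ≤ K * q ^ (T.card - 1) := by
        rw [div_le_iff₀ hq, mul_assoc, ← pow_succ, Nat.sub_add_cancel hT.card_pos]
        exact wdeg_freeLink_le hK hq hw v T
      linarith
    · have h0 : wdeg (freeLink K q w u v) T = 0 := by
        refine Finset.sum_eq_zero fun f hf => if_neg fun h => hsat ?_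
        exact h.2 T (Finset.mem_filter.1 hf).2 hT
      rw [h0, zero_div, add_zero]
      exact hu.wdeg_le T hT

lemma BoundedWeight.greedyWeight (hK : 0 ≤ K) (hq : 0 < q)
    (hw : BoundedWeight (k + 1) A K q w) (hu : BoundedWeight k A (2 * K) q u) (l : List V) :
    BoundedWeight k A (2 * K) q (greedyWeight K q β w X l u) := by
  induction l generalizing u with
  | nil => exact hu
  | cons v l ih => exact ih (hw.greedyStep hK hq hu v)

lemma BoundedWeight.zero (hK : 0 ≤ K) (hq : 0 < q) : BoundedWeight k A K q (fun _ => 0) where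
  nonneg _ := le_rfl
  card_eq _ h := absurd rfl h
  subset _ h := absurd rfl h
  wdeg_le T _ := by
    simp only [wdeg, Finset.sum_const_zero]
    positivity

/-- A set that is independent in `w` remains independent in the greedy weight it produces. -/
lemma greedyWeight_eq_zero (hX : ∀ e ⊆ X, w e = 0) (hu : ∀ e ⊆ X, u e = 0) (l : List V) :
    ∀ e ⊆ X, greedyWeight K q β w X l u e = 0 := by
  induction l generalizing u with
  | nil => exact hu
  | cons v l ih =>
    refine ih fun e he => ?_
    unfold greedyStep
    split_ifs with h
    · simp [freeLink, hu e he, hX _ (Finset.insert_subset h.1 he)]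
    · exact hu e he

/-- A weight all of whose edges are nonempty is dominated by the sum of its vertex degrees. -/
lemma sum_le_sum_wdeg (hw : BoundedWeight k A K q w) (hk : k ≠ 0) :
    ∑ e, w e ≤ ∑ v ∈ A, wdeg w {v} := by
  simp only [wdeg, Finset.sum_filter]
  rw [Finset.sum_comm]
  refine Finset.sum_le_sum fun e _ => ?_
  by_cases he : w e = 0
  · simp [he]
  obtain ⟨v, hv⟩ := Finset.card_pos.1 (Nat.pos_of_ne_zero (hw.card_eq e he ▸ hk))
  calc w e = if {v} ⊆ e then w e else 0 := by simp [hv]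
    _ ≤ _ := Finset.single_le_sum (f := fun v => if {v} ⊆ e then w e else 0)
        (fun x _ => by have := hw.nonneg e; split_ifs <;> simp [this])
        (hw.subset e he hv)

lemma BoundedWeight.sum_le (hw : BoundedWeight k A K q w) (hk : k ≠ 0) :
    ∑ e, w e ≤ K * A.card := by
  refine (sum_le_sum_wdeg hw hk).trans ?_
  calc ∑ v ∈ A, wdeg w {v} ≤ ∑ v ∈ A, K :=
        Finset.sum_le_sum fun v _ => by simpa using hw.wdeg_le {v} (Finset.singleton_nonempty v)
    _ = K * A.card := by rw [Finset.sum_const, nsmul_eq_mul, mul_comm]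

/-- The edges of `w` containing a set saturated in `u` have weight at most `2 ^ k` times the
weight of `u`. -/
lemma sum_saturated_le (hw : BoundedWeight (k + 1) A K q w) (hu : ∀ f, 0 ≤ u f)
    (hcard : ∀ f, u f ≠ 0 → f.card = k) :
    ∑ e with ¬ Unsaturated K q u e, w e ≤ 2 ^ k * ∑ f, u f := by
  calc ∑ e with ¬ Unsaturated K q u e, w e
      ≤ ∑ e, ∑ T ∈ e.powerset with T.Nonempty ∧ K * q ^ (T.card - 1) ≤ wdeg u T, w e := by
        rw [Finset.sum_filter]
        refine Finset.sum_le_sum fun e _ => ?_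
        split_ifs with he
        · exact Finset.sum_nonneg fun _ _ => hw.nonneg e
        · unfold Unsaturated at he
          push Not at he
          obtain ⟨T, hT, hne, hsat⟩ := he
          exact Finset.single_le_sum (f := fun _ => w e) (fun _ _ => hw.nonneg e)
            (Finset.mem_filter.2 ⟨Finset.mem_powerset.2 hT, hne, hsat⟩)
    _ = ∑ T with T.Nonempty ∧ K * q ^ (T.card - 1) ≤ wdeg u T, wdeg w T := by
        unfold wdeg
        refine Finset.sum_comm' fun e T => ?_
        simp
    _ ≤ ∑ T with T.Nonempty ∧ K * q ^ (T.card - 1) ≤ wdeg u T, wdeg u T :=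
        Finset.sum_le_sum fun T hT => by
          have := (Finset.mem_filter.1 hT).2
          exact (hw.wdeg_le T this.1).trans this.2
    _ ≤ ∑ T, wdeg u T :=
        Finset.sum_le_sum_of_subset_of_nonneg (Finset.filter_subset _ _)
          fun T _ _ => Finset.sum_nonneg fun f _ => hu f
    _ = ∑ f, ∑ T ∈ f.powerset, u f := by
        unfold wdeg
        refine Finset.sum_comm' fun e T => ?_
        simp
    _ = 2 ^ k * ∑ f, u f := by
        rw [Finset.mul_sum]
        refine Finset.sum_congr rfl fun f _ => ?_
        by_cases hf : u f = 0
        · simp [hf]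
        · simp [hcard f hf]

/-- If `u` is light, then many vertices of `A` have large gain. -/
lemma le_card_gain (hw : BoundedWeight (k + 1) A K q w) (hβ : 0 ≤ β) (hu : ∀ f, 0 ≤ u f)
    (hcard : ∀ f, u f ≠ 0 → f.card = k) :
    ∑ e, w e ≤ 2 ^ k * ∑ f, u f + β * A.card + K * (A.filter fun v => β ≤ gain K q w u v).card := by
  have hsplit := Finset.sum_filter_add_sum_filter_not Finset.univ
    (fun e => Unsaturated K q u e) w
  have hsat := sum_saturated_le hw hu hcard
  set w' : Finset V → ℝ := fun e => if Unsaturated K q u e then w e else 0 with hw'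
  have hle : ∀ e, w' e ≤ w e := fun e => by
    have := hw.nonneg e
    simp only [hw']
    split_ifs <;> simp [this]
  have hb : BoundedWeight (k + 1) A K q w' :=
    { nonneg := fun e => by
        have := hw.nonneg e
        simp only [hw']
        split_ifs <;> simp [this]
      card_eq := fun e he => hw.card_eq e fun h => he (by simp [hw', h])
      subset := fun e he => hw.subset e fun h => he (by simp [hw', h])
      wdeg_le := fun T hT => (wdeg_mono hle T).trans (hw.wdeg_le T hT) }
  have hdeg : ∀ v, wdeg w' {v} ≤ gain K q w u v := fun v => by
    calc wdeg w' {v} = ∑ e with v ∈ e, w' e := by simp [wdeg]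
      _ = ∑ f with v ∉ f, w' (insert v f) := by
        refine Finset.sum_nbij' (fun e => e.erase v) (fun f => insert v f) ?_ ?_ ?_ ?_ ?_
        · simp
        · simp
        · intro e he
          simp at he
          simp [he]
        · intro f hf
          simp at hf
          simp [hf]
        · intro e he
          simp at he
          simp [he]
      _ ≤ gain K q w u v := by
        unfold gain
        rw [Finset.sum_filter]
        refine Finset.sum_le_sum fun f _ => ?_
        have h0 := hw.nonneg (insert v f)
        have hmono : Unsaturated K q u (insert v f) → Unsaturated K q u f :=
          fun h T hT => h T (hT.trans (Finset.subset_insert _ _))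
        simp only [hw', freeLink]
        split_ifs <;> simp_all
  have hfree : ∑ e with Unsaturated K q u e, w e ≤
      β * A.card + K * (A.filter fun v => β ≤ gain K q w u v).card := by
    rw [Finset.sum_filter]
    refine (sum_le_sum_wdeg hb k.succ_ne_zero).trans ?_
    calc ∑ v ∈ A, wdeg w' {v} ≤ ∑ v ∈ A, (β + if β ≤ gain K q w u v then K else 0) := by
          refine Finset.sum_le_sum fun v _ => ?_
          split_ifs with h
          · have := hb.wdeg_le {v} (Finset.singleton_nonempty v)
            simp at this
            linarith
          · have := hdeg v
            linarith
      _ = _ := by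
          rw [Finset.sum_add_distrib, ← Finset.sum_filter, Finset.sum_const, Finset.sum_const,
            nsmul_eq_mul, nsmul_eq_mul, mul_comm β, mul_comm K]
  linarith

end Greedy

/-- `S` is a legal fingerprint of `X`: a subset of `X` with at most `m` elements. -/
def IsFingerprint {V : Type*} (m : ℝ) (X S : Finset V) : Prop :=
  S ⊆ X ∧ (S.card : ℝ) ≤ m

/-- In a weighted `k`-uniform hypergraph of large total weight and bounded degrees, every
independent set `X` avoids a large set of vertices that depends only on `k` small subsets
of `X`. -/
theorem exists_avoided_set (k : ℕ) (hk : 1 ≤ k) : ∀ K c : ℝ, 0 < K → 0 < c →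
    ∃ b γ q₀ : ℝ, 0 < b ∧ 0 < γ ∧ 0 < q₀ ∧
      ∀ (V : Type) [Fintype V] (A : Finset V) (q : ℝ) (w : Finset V → ℝ), 0 < q → q ≤ q₀ →
        BoundedWeight k A K q w → c * Fintype.card V ≤ ∑ e, w e →
        ∃ D : List (Finset V) → Finset V, ∀ X : Finset V, (∀ e ⊆ X, w e = 0) →
          ∃ L : List (Finset V), L.length = k ∧
            (∀ S ∈ L, IsFingerprint (b * q * Fintype.card V) X S) ∧
            Disjoint (D L) X ∧ D L ⊆ A ∧ γ * Fintype.card V ≤ (D L).card := by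
  induction k, hk using Nat.le_induction with
  | base =>
    intro K c hK hc
    refine ⟨1, c / K, 1, one_pos, by positivity, one_pos, ?_⟩
    intro V _ A q w hq _ hw hmass
    refine ⟨fun _ => A.filter fun v => w {v} ≠ 0, fun X hX => ⟨[∅], rfl, ?_, ?_, ?_, ?_⟩⟩
    · intro S hS
      rw [List.mem_singleton.1 hS]
      exact ⟨Finset.empty_subset _, by rw [Finset.card_empty, Nat.cast_zero]; positivity⟩
    · refine Finset.disjoint_left.2 fun v hv hvX => (Finset.mem_filter.1 hv).2 ?_
      exact hX _ (Finset.singleton_subset_iff.2 hvX)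
    · exact Finset.filter_subset _ _
    · have hw' : BoundedWeight 1 (A.filter fun v => w {v} ≠ 0) K q w :=
        { hw with
          subset := fun e he => by
            obtain ⟨v, rfl⟩ := Finset.card_eq_one.1 (hw.card_eq e he)
            have := hw.subset _ he
            simp_all }
      have := hmass.trans (hw'.sum_le one_ne_zero)
      rw [div_mul_eq_mul_div, div_le_iff₀ hK]
      linarith
  | succ k hk ih =>
    intro K c hK hc
    obtain ⟨b, γ, q₀, hb, hγ, hq₀, ih⟩ := ih (2 * K) (c / 2 ^ (k + 2)) (by positivity)
      (by positivity)
    refine ⟨max b (8 * K / c), min γ (c / (4 * K)), min q₀ (c ^ 2 / (32 * K ^ 2)),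
      lt_max_of_lt_left hb, lt_min hγ (by positivity), lt_min hq₀ (by positivity), ?_⟩
    intro V _ A q w hq hqle hw hmass
    set N : ℝ := (Fintype.card V : ℝ) with hN
    have hN0 : 0 ≤ N := by positivity
    have hAN : (A.card : ℝ) ≤ N := by
      rw [hN]
      exact_mod_cast Finset.card_le_univ A
    let l : List V := Finset.univ.toList
    let u : Finset V → Finset V → ℝ := fun S => greedyWeight K q (c / 4) w S l fun _ => 0
    have hu : ∀ S, BoundedWeight k A (2 * K) q (u S) := fun S =>
      hw.greedyWeight hK.le hq (BoundedWeight.zero (by positivity) hq) l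
    have hdense : ∀ S, c / 2 ^ (k + 2) * N ≤ ∑ f, u S f →
        ∃ D : List (Finset V) → Finset V, ∀ X : Finset V, (∀ e ⊆ X, u S e = 0) →
          ∃ L : List (Finset V), L.length = k ∧
            (∀ S ∈ L, IsFingerprint (b * q * N) X S) ∧
            Disjoint (D L) X ∧ D L ⊆ A ∧ γ * N ≤ (D L).card :=
      fun S hS => ih V A q (u S) hq (hqle.trans (min_le_left _ _)) (hu S) hS
    choose! D' hD' using hdense
    let D : List (Finset V) → Finset V := fun L =>
      if c / 2 ^ (k + 2) * N ≤ ∑ f, u L.headI f then D' L.headI L.tail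
      else (A.filter fun v => c / 4 ≤ gain K q w (u L.headI) v) \ L.headI
    refine ⟨D, fun X hX => ?_⟩
    set S := greedySet K q (c / 4) w X l fun _ => 0
    have hSX : S ⊆ X := greedySet_subset l
    have huS : u S = u X := greedyWeight_eq_of_subset l subset_rfl hSX
    have hSle : (S.card : ℝ) ≤ 8 * K / c * q * N := by
      have h1 := card_greedySet_le (K := K) (w := w) (X := X) (u := fun _ => 0) hq
        (show 0 < c / 4 by positivity) l
      have h2 := (hu X).sum_le (by omega)
      rw [Finset.sum_const_zero, zero_add] at h1
      have h3 : (S.card : ℝ) * (c / 4 / q) ≤ 2 * K * N :=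
        h1.trans (h2.trans (by gcongr))
      rw [← le_div_iff₀ (by positivity)] at h3
      refine h3.trans_eq ?_
      field_simp
      ring
    have hfinger : IsFingerprint (max b (8 * K / c) * q * N) X S :=
      ⟨hSX, hSle.trans (by gcongr; exact le_max_right _ _)⟩
    by_cases hcase : c / 2 ^ (k + 2) * N ≤ ∑ f, u S f
    · have hind : ∀ e ⊆ X, u S e = 0 := by
        rw [huS]
        exact greedyWeight_eq_zero hX (fun _ _ => rfl) l
      obtain ⟨L, hlen, hL, hdisj, hsub, hcard⟩ := hD' S hcase X hind
      refine ⟨S :: L, by simp [hlen], ?_, ?_⟩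
      · intro R hR
        rcases List.mem_cons.1 hR with rfl | hR
        · exact hfinger
        · exact ⟨(hL R hR).1, (hL R hR).2.trans (by gcongr; exact le_max_left _ _)⟩
      · have hDL : D (S :: L) = D' S L := if_pos hcase
        rw [hDL]
        exact ⟨hdisj, hsub, le_trans (by gcongr; exact min_le_left _ _) hcard⟩
    · refine ⟨S :: List.replicate k ∅, by simp, ?_, ?_⟩
      · intro R hR
        rcases List.mem_cons.1 hR with rfl | hR
        · exact hfinger
        · rw [List.eq_of_mem_replicate hR]
          exact ⟨Finset.empty_subset _, by rw [Finset.card_empty, Nat.cast_zero]; positivity⟩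
      have hDL : D (S :: List.replicate k ∅) =
          (A.filter fun v => c / 4 ≤ gain K q w (u S) v) \ S := if_neg hcase
      rw [hDL]
      refine ⟨?_, ?_, ?_⟩
      · refine Finset.disjoint_left.2 fun v hv hvX => ?_
        simp only [Finset.mem_sdiff, Finset.mem_filter] at hv
        rcases mem_greedySet_or_gain_lt (K := K) (β := c / 4) (u := fun _ => 0) hw.nonneg hq l
          (Finset.mem_toList.2 (Finset.mem_univ v)) hvX with h | h
        · exact hv.2 h
        · rw [huS] at hv
          exact absurd hv.1.2 (not_le.2 h)
      · exact Finset.sdiff_subset.trans (Finset.filter_subset _ _)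
      · set B := A.filter fun v => c / 4 ≤ gain K q w (u S) v
        have h1 := le_card_gain hw (show 0 ≤ c / 4 by positivity) (hu S).nonneg (hu S).card_eq
        have h2 : (B.card : ℝ) - S.card ≤ (B \ S).card := by
          have := Finset.le_card_sdiff S B
          rw [sub_le_iff_le_add]
          exact_mod_cast Nat.sub_le_iff_le_add.1 this
        have h3 : 2 ^ k * ∑ f, u S f ≤ c / 4 * N := by
          calc 2 ^ k * ∑ f, u S f ≤ 2 ^ k * (c / 2 ^ (k + 2) * N) := by
                gcongr
                exact (not_le.1 hcase).le
            _ = c / 4 * N := by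
                rw [pow_add]
                field_simp
                ring
        have h4 : c / 4 * A.card ≤ c / 4 * N := by gcongr
        have h5 : c / (2 * K) * N ≤ B.card := by
          rw [div_mul_eq_mul_div, div_le_iff₀ (by positivity)]
          linarith
        have h6 : 8 * K / c * q * N ≤ c / (4 * K) * N := by
          gcongr
          calc 8 * K / c * q ≤ 8 * K / c * (c ^ 2 / (32 * K ^ 2)) := by
                gcongr
                exact hqle.trans (min_le_right _ _)
            _ = c / (4 * K) := by
                field_simp
                ring
        have h7 : c / (2 * K) * N = c / (4 * K) * N + c / (4 * K) * N := by
          field_simp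
          ring
        have h8 : min γ (c / (4 * K)) * N ≤ c / (4 * K) * N := by
          gcongr
          exact min_le_right _ _
        linarith

/-- The container lemma: every independent set `X` lies in a set of small weight that depends only
on a bounded number of small subsets of `X`. -/
theorem exists_containers {k : ℕ} (hk : 1 ≤ k) {K ε : ℝ} (hK : 0 < K) (hε : 0 < ε) :
    ∃ (b q₀ : ℝ) (m : ℕ), 0 < b ∧ 0 < q₀ ∧
      ∀ (V : Type) [Fintype V] [Nonempty V] (q : ℝ) (w : Finset V → ℝ), 0 < q → q ≤ q₀ →
        BoundedWeight k Finset.univ K q w →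
        ∃ F : List (Finset V) → Finset V, ∀ X : Finset V, (∀ e ⊆ X, w e = 0) →
          ∃ L : List (Finset V), L.length = m ∧
            (∀ S ∈ L, IsFingerprint (b * q * Fintype.card V) X S) ∧
            X ⊆ F L ∧ ∑ e with e ⊆ F L, w e < ε * Fintype.card V := by
  obtain ⟨b, γ, q₀, hb, hγ, hq₀, h⟩ := exists_avoided_set k hk K ε hK hε
  obtain ⟨J, hJ⟩ := exists_nat_gt (1 / γ)
  refine ⟨b, q₀, J * k, hb, hq₀, fun V _ _ q w hq hqle hw => ?_⟩
  set N : ℝ := (Fintype.card V : ℝ) with hN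
  have hN0 : 0 < N := by
    rw [hN]
    exact_mod_cast Fintype.card_pos
  have hstep : ∀ A : Finset V, ε * N ≤ ∑ e with e ⊆ A, w e →
      ∃ D : List (Finset V) → Finset V, ∀ X : Finset V, (∀ e ⊆ X, w e = 0) →
        ∃ L : List (Finset V), L.length = k ∧ (∀ S ∈ L, IsFingerprint (b * q * N) X S) ∧
          Disjoint (D L) X ∧ D L ⊆ A ∧ γ * N ≤ (D L).card := by
    intro A hA
    set w' : Finset V → ℝ := fun e => if e ⊆ A then w e else 0 with hw'
    have hle : ∀ e, w' e ≤ w e := fun e => by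
      have := hw.nonneg e
      simp only [hw']
      split_ifs <;> simp [this]
    have hb : BoundedWeight k A K q w' :=
      { nonneg := fun e => by
          have := hw.nonneg e
          simp only [hw']
          split_ifs <;> simp [this]
        card_eq := fun e he => hw.card_eq e fun h => he (by simp [hw', h])
        subset := fun e he => by
          by_contra hne
          exact he (if_neg hne)
        wdeg_le := fun T hT => (wdeg_mono hle T).trans (hw.wdeg_le T hT) }
    obtain ⟨D, hD⟩ := h V A q w' hq hqle hb (by rwa [Finset.sum_filter] at hA)
    exact ⟨D, fun X hX => hD X fun e he => by simp [hw', hX e he]⟩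
  choose! D hD using hstep
  have key : ∀ j : ℕ, ∃ F : List (Finset V) → Finset V, ∀ X : Finset V, (∀ e ⊆ X, w e = 0) →
      ∃ L : List (Finset V), L.length = j * k ∧ (∀ S ∈ L, IsFingerprint (b * q * N) X S) ∧
        X ⊆ F L ∧ (∑ e with e ⊆ F L, w e < ε * N ∨ ((F L).card : ℝ) ≤ N - j * (γ * N)) := by
    intro j
    induction j with
    | zero =>
      refine ⟨fun _ => Finset.univ, fun X _ => ⟨[], by simp, by simp, Finset.subset_univ _,
        Or.inr ?_⟩⟩
      simp [hN]
    | succ j ih =>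
      obtain ⟨F, hF⟩ := ih
      refine ⟨fun L => if ε * N ≤ ∑ e with e ⊆ F (L.take (j * k)), w e then
        F (L.take (j * k)) \ D (F (L.take (j * k))) (L.drop (j * k))
        else F (L.take (j * k)), fun X hX => ?_⟩
      obtain ⟨L, hlen, hL, hsub, hsmall⟩ := hF X hX
      have happ : ∀ L', (L ++ L').take (j * k) = L ∧ (L ++ L').drop (j * k) = L' := fun L' => by
        rw [← hlen]
        simp
      by_cases hcase : ε * N ≤ ∑ e with e ⊆ F L, w e
      · obtain ⟨L', hlen', hL', hdisj, hDsub, hDcard⟩ := hD (F L) hcase X hX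
        refine ⟨L ++ L', by rw [List.length_append, hlen, hlen']; ring, ?_, ?_⟩
        · intro S hS
          exact (List.mem_append.1 hS).elim (hL S) (hL' S)
        · simp only [(happ L').1, (happ L').2, if_pos hcase]
          refine ⟨Finset.subset_sdiff.2 ⟨hsub, hdisj.symm⟩, Or.inr ?_⟩
          have h1 := hsmall.resolve_left (not_lt.2 hcase)
          rw [Finset.card_sdiff_of_subset hDsub, Nat.cast_sub (Finset.card_le_card hDsub)]
          push_cast
          linarith
      · refine ⟨L ++ List.replicate k ∅, by simp [hlen]; ring, ?_, ?_⟩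
        · intro S hS
          rcases List.mem_append.1 hS with hS | hS
          · exact hL S hS
          · rw [List.eq_of_mem_replicate hS]
            exact ⟨Finset.empty_subset _, by rw [Finset.card_empty, Nat.cast_zero]; positivity⟩
        · simp only [(happ _).1, if_neg hcase]
          exact ⟨hsub, Or.inl (not_le.1 hcase)⟩
  obtain ⟨F, hF⟩ := key J
  refine ⟨F, fun X hX => ?_⟩
  obtain ⟨L, hlen, hL, hsub, hsmall⟩ := hF X hX
  refine ⟨L, hlen, hL, hsub, hsmall.resolve_right fun hcard => ?_⟩
  rw [div_lt_iff₀ hγ] at hJ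
  have h1 : (0 : ℝ) ≤ (F L).card := Nat.cast_nonneg _
  nlinarith

/-- The probability that the binomial random subset contains `U` and avoids `D`. -/
lemma sum_cylinder_le {V : Type*} [Fintype V] {p : ℝ} (hp0 : 0 ≤ p) (hp1 : p ≤ 1)
    (U D : Finset V) :
    ∑ Z : Finset V, (if U ⊆ Z ∧ Disjoint D Z then
      p ^ Z.card * (1 - p) ^ (Fintype.card V - Z.card) else 0) ≤
      p ^ U.card * (1 - p) ^ D.card := by
  have h1p : 0 ≤ 1 - p := by linarith
  calc ∑ Z : Finset V, (if U ⊆ Z ∧ Disjoint D Z then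
        p ^ Z.card * (1 - p) ^ (Fintype.card V - Z.card) else 0)
      = ∑ Z : Finset V, (∏ i ∈ Z, if i ∈ D then 0 else p) *
          ∏ i ∈ Finset.univ \ Z, (if i ∈ U then 0 else 1 - p) := by
        refine Finset.sum_congr rfl fun Z _ => ?_
        split_ifs with h
        · rw [Finset.prod_congr rfl fun i hi => if_neg (Finset.disjoint_right.1 h.2 hi),
            Finset.prod_congr rfl fun i hi => if_neg fun hU => (Finset.mem_sdiff.1 hi).2 (h.1 hU),
            Finset.prod_const, Finset.prod_const,
            Finset.card_sdiff_of_subset (Finset.subset_univ Z), Finset.card_univ]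
        · rw [not_and_or, Finset.not_subset, Finset.not_disjoint_iff] at h
          rcases h with ⟨i, hU, hZ⟩ | ⟨i, hD, hZ⟩
          · refine (mul_eq_zero_of_right _ (Finset.prod_eq_zero (i := i) (by simp [hZ]) ?_)).symm
            exact if_pos hU
          · refine (mul_eq_zero_of_left (Finset.prod_eq_zero (i := i) hZ ?_) _).symm
            exact if_pos hD
    _ = ∏ i : V, ((if i ∈ D then 0 else p) + if i ∈ U then 0 else 1 - p) := by
        rw [Finset.prod_add, Finset.powerset_univ]
    _ ≤ ∏ i : V, ((if i ∈ U then p else 1) * if i ∈ D then 1 - p else 1) := by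
        refine Finset.prod_le_prod (fun i _ => ?_) fun i _ => ?_
        · split_ifs <;> simp [hp0, hp1]
        · split_ifs <;> simp [mul_nonneg hp0 h1p]
    _ = p ^ U.card * (1 - p) ^ D.card := by
        rw [Finset.prod_mul_distrib]
        simp [Finset.prod_ite_mem]

/-- A union bound over fingerprints: if every `Z` with property `P` contains a set `U` of at most
`B` elements and avoids a set of at least `d` vertices determined by subsets of `U`, then `P` is
unlikely to hold for the binomial random subset. -/
theorem probSub_le_exp {V ι : Type*} [Fintype V] [Fintype ι] {p B d Λ : ℝ} (hp0 : 0 ≤ p)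
    (hp1 : p ≤ 1) (hΛ : 0 ≤ Λ) {P : Finset V → Prop} (D : (ι → Finset V) → Finset V)
    (h : ∀ Z, P Z → ∃ U ⊆ Z, (U.card : ℝ) ≤ B ∧ ∃ L : ι → Finset V, (∀ i, L i ⊆ U) ∧
      Disjoint (D L) Z ∧ d ≤ (D L).card) :
    probSub Finset.univ p P ≤
      Real.exp (Λ * B + 2 ^ Fintype.card ι * Real.exp (-Λ) * p * Fintype.card V - p * d) := by
  have h1p : 0 ≤ 1 - p := by linarith
  set μ : Finset V → ℝ := fun Z => p ^ Z.card * (1 - p) ^ (Fintype.card V - Z.card) with hμ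
  have hμ0 : ∀ Z, 0 ≤ μ Z := fun Z => by positivity
  set codes : Finset V → Finset (ι → Finset V) := fun U =>
    (Fintype.piFinset fun _ => U.powerset).filter fun L => d ≤ (D L).card with hcodes
  have hcard : ∀ U, ((codes U).card : ℝ) ≤ (2 ^ Fintype.card ι) ^ U.card := fun U => by
    have : (codes U).card ≤ (2 ^ Fintype.card ι) ^ U.card := by
      refine (Finset.card_filter_le _ _).trans_eq ?_
      simp [Fintype.card_piFinset, ← pow_mul, mul_comm]
    exact_mod_cast this
  calc probSub Finset.univ p P
      = ∑ Z : Finset V, if P Z then μ Z else 0 := by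
        simp [probSub, hμ, Finset.card_univ]
    _ ≤ ∑ Z : Finset V, ∑ U with ((U : Finset V).card : ℝ) ≤ B, ∑ L ∈ codes U,
          if U ⊆ Z ∧ Disjoint (D L) Z then μ Z else 0 := by
        have hnn : ∀ (Z U : Finset V) (L : ι → Finset V),
            0 ≤ if U ⊆ Z ∧ Disjoint (D L) Z then μ Z else 0 := fun Z U L => by
          split_ifs
          exacts [hμ0 Z, le_rfl]
        refine Finset.sum_le_sum fun Z _ => ?_
        split_ifs with hZ
        · obtain ⟨U, hUZ, hUB, L, hLU, hdisj, hd⟩ := h Z hZ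
          have hL : L ∈ codes U := by simp [hcodes, hLU, hd]
          calc μ Z = if U ⊆ Z ∧ Disjoint (D L) Z then μ Z else 0 := (if_pos ⟨hUZ, hdisj⟩).symm
            _ ≤ ∑ L ∈ codes U, if U ⊆ Z ∧ Disjoint (D L) Z then μ Z else 0 :=
              Finset.single_le_sum (f := fun L => if U ⊆ Z ∧ Disjoint (D L) Z then μ Z else 0)
                (fun L _ => hnn Z U L) hL
            _ ≤ _ :=
              Finset.single_le_sum (f := fun U => ∑ L ∈ codes U,
                if U ⊆ Z ∧ Disjoint (D L) Z then μ Z else 0)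
                (fun U _ => Finset.sum_nonneg fun L _ => hnn Z U L) (by simp [hUB])
        · exact Finset.sum_nonneg fun U _ => Finset.sum_nonneg fun L _ => hnn Z U L
    _ = ∑ U with ((U : Finset V).card : ℝ) ≤ B, ∑ L ∈ codes U, ∑ Z : Finset V,
          if U ⊆ Z ∧ Disjoint (D L) Z then μ Z else 0 := by
        rw [Finset.sum_comm]
        exact Finset.sum_congr rfl fun U _ => Finset.sum_comm
    _ ≤ ∑ U with ((U : Finset V).card : ℝ) ≤ B, ∑ L ∈ codes U,
          p ^ U.card * Real.exp (-(p * d)) := by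
        refine Finset.sum_le_sum fun U _ => Finset.sum_le_sum fun L hL => ?_
        refine (sum_cylinder_le hp0 hp1 U (D L)).trans ?_
        gcongr
        have hd : d ≤ (D L).card := (Finset.mem_filter.1 hL).2
        calc (1 - p) ^ (D L).card ≤ Real.exp (-p) ^ (D L).card := by
              gcongr
              exact Real.one_sub_le_exp_neg p
          _ = Real.exp (-(p * (D L).card)) := by
              rw [← Real.exp_nat_mul]
              ring_nf
          _ ≤ Real.exp (-(p * d)) := by gcongr
    _ ≤ ∑ U with ((U : Finset V).card : ℝ) ≤ B, Real.exp (Λ * B - p * d) *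
          (2 ^ Fintype.card ι * Real.exp (-Λ) * p) ^ U.card := by
        refine Finset.sum_le_sum fun U hU => ?_
        have hUB : (U.card : ℝ) ≤ B := (Finset.mem_filter.1 hU).2
        have h1 : (1 : ℝ) ≤ Real.exp (Λ * B) * Real.exp (-Λ) ^ U.card := by
          rw [← Real.exp_nat_mul, ← Real.exp_add]
          refine Real.one_le_exp ?_
          nlinarith
        rw [Finset.sum_const, nsmul_eq_mul]
        calc ((codes U).card : ℝ) * (p ^ U.card * Real.exp (-(p * d)))
            ≤ (2 ^ Fintype.card ι) ^ U.card * (p ^ U.card * Real.exp (-(p * d))) := by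
              gcongr
              exact hcard U
          _ ≤ (2 ^ Fintype.card ι) ^ U.card * (p ^ U.card * Real.exp (-(p * d))) *
                (Real.exp (Λ * B) * Real.exp (-Λ) ^ U.card) :=
              le_mul_of_one_le_right (by positivity) h1
          _ = _ := by
              rw [sub_eq_add_neg, Real.exp_add, mul_pow, mul_pow]
              ring
    _ ≤ ∑ U : Finset V, Real.exp (Λ * B - p * d) *
          (2 ^ Fintype.card ι * Real.exp (-Λ) * p) ^ U.card :=
        Finset.sum_le_sum_of_subset_of_nonneg (Finset.filter_subset _ _)
          fun U _ _ => by positivity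
    _ = Real.exp (Λ * B - p * d) *
          (2 ^ Fintype.card ι * Real.exp (-Λ) * p + 1) ^ Fintype.card V := by
        rw [← Finset.mul_sum, ← Finset.card_univ (α := V),
          ← Finset.sum_pow_mul_eq_add_pow, Finset.powerset_univ]
        simp
    _ ≤ Real.exp (Λ * B - p * d) *
          Real.exp (2 ^ Fintype.card ι * Real.exp (-Λ) * p) ^ Fintype.card V := by
        gcongr
        exact Real.add_one_le_exp _
    _ = _ := by
        rw [← Real.exp_nat_mul, ← Real.exp_add]
        ring_nf

/-- The weight on the edges of `H` with total weight `v(H)`. -/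
noncomputable def edgeWeight {V : Type*} [Fintype V] (H : Finset (Finset V)) (e : Finset V) : ℝ :=
  if e ∈ H then (Fintype.card V : ℝ) / H.card else 0

section EdgeWeight

variable {V : Type*} [Fintype V] {H : Finset (Finset V)}

lemma sum_edgeWeight (P : Finset V → Prop) [DecidablePred P] :
    ∑ e with P e, edgeWeight H e = (H.filter P).card * ((Fintype.card V : ℝ) / H.card) := by
  simp only [edgeWeight]
  rw [← Finset.sum_filter, Finset.sum_const, nsmul_eq_mul, Finset.filter_filter]
  congr 3
  ext e
  simp [and_comm]

lemma degH_le_maxDeg (T : Finset V) : degH H T ≤ maxDeg H T.card :=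
  Finset.le_sup (f := degH H) (by simp)

lemma pH_pow {s : ℕ} (hs : 2 ≤ s) :
    pH s H ^ (s - 1) = (Fintype.card V : ℝ) / H.card := by
  have hs' : ((s - 1 : ℕ) : ℝ) = s - 1 := by
    rw [Nat.cast_sub (by omega), Nat.cast_one]
  rw [pH, ← hs', one_div, Real.rpow_inv_natCast_pow (by positivity) (by omega)]

lemma boundedWeight_edgeWeight [Nonempty V] {s : ℕ} (hs : 2 ≤ s) (hne : H.Nonempty)
    (hunif : ∀ e ∈ H, e.card = s) {K : ℝ} (hK : 1 ≤ K)
    (h1 : (maxDeg H 1 : ℝ) ≤ K * H.card / Fintype.card V)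
    (ht : ∀ t ∈ Finset.Icc 2 (s - 1),
      (maxDeg H t : ℝ) ≤ 1 * pH s H ^ (t - 1) * H.card / Fintype.card V) :
    BoundedWeight s Finset.univ K (pH s H) (edgeWeight H) := by
  have hH : (0 : ℝ) < H.card := by exact_mod_cast hne.card_pos
  have hN : (0 : ℝ) < Fintype.card V := by exact_mod_cast Fintype.card_pos
  have hmem : ∀ e, edgeWeight H e ≠ 0 → e ∈ H := fun e he => by
    by_contra h
    exact he (if_neg h)
  refine ⟨fun e => ?_, fun e he => hunif e (hmem e he), fun e _ => Finset.subset_univ e,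
    fun T hT => ?_⟩
  · unfold edgeWeight
    split_ifs <;> positivity
  have hq : 0 ≤ pH s H := Real.rpow_nonneg (by positivity) _
  have hdeg : wdeg (edgeWeight H) T = degH H T * ((Fintype.card V : ℝ) / H.card) :=
    sum_edgeWeight _
  rw [hdeg]
  have hpos := hT.card_pos
  rcases lt_trichotomy T.card s with hlt | heq | hgt
  · have hmax : (degH H T : ℝ) ≤ maxDeg H T.card := by exact_mod_cast degH_le_maxDeg T
    have hbound : (maxDeg H T.card : ℝ) ≤ K * pH s H ^ (T.card - 1) * H.card / Fintype.card V := by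
      rcases Nat.lt_or_ge T.card 2 with h | h
      · have : T.card = 1 := by omega
        simpa [this] using h1
      · refine (ht T.card (Finset.mem_Icc.2 ⟨h, by omega⟩)).trans ?_
        gcongr
    calc (degH H T : ℝ) * ((Fintype.card V : ℝ) / H.card)
        ≤ (K * pH s H ^ (T.card - 1) * H.card / Fintype.card V) *
            ((Fintype.card V : ℝ) / H.card) := by
          gcongr
          exact hmax.trans hbound
      _ = K * pH s H ^ (T.card - 1) := by field_simp
  · have hle : degH H T ≤ 1 := by
      refine Finset.card_le_one.2 fun a ha b hb => ?_
      rw [Finset.mem_filter] at ha hb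
      rw [← Finset.eq_of_subset_of_card_le ha.2 (by rw [hunif a ha.1, heq]),
        ← Finset.eq_of_subset_of_card_le hb.2 (by rw [hunif b hb.1, heq])]
    rw [heq, pH_pow hs]
    gcongr
    exact le_trans (by exact_mod_cast hle) hK
  · have h0 : degH H T = 0 := by
      refine Finset.card_eq_zero.2 (Finset.filter_eq_empty_iff.2 fun e he hTe => ?_)
      have := Finset.card_le_card hTe
      rw [hunif e he] at this
      omega
    rw [h0, Nat.cast_zero, zero_mul]
    positivity

/-- If every colouring has many monochromatic edges, then sets that each span few edges leave many
vertices uncovered. -/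
lemma le_card_compl_biUnion {r s : ℕ} [NeZero r] {K q δ ε : ℝ} (hne : H.Nonempty)
    (hw : BoundedWeight s Finset.univ K q (edgeWeight H))
    (hrob : ∀ c : V → Fin r, δ * (H.card : ℝ) ≤
      (Nat.card {e : Finset V // e ∈ H ∧ ∃ i : Fin r, ∀ v ∈ e, c v = i} : ℝ))
    (F : Fin r → Finset V)
    (hF : ∀ i, ∑ e with e ⊆ F i, edgeWeight H e < ε * Fintype.card V) :
    (δ - r * ε) * Fintype.card V ≤ K * (Finset.univ \ Finset.univ.biUnion F).card := by
  set D := Finset.univ \ Finset.univ.biUnion F with hD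
  have hH : (0 : ℝ) < H.card := by exact_mod_cast hne.card_pos
  let c : V → Fin r := fun v => if h : ∃ i, v ∈ F i then h.choose else 0
  have hc : ∀ v ∉ D, v ∈ F (c v) := fun v hv => by
    have h : ∃ i, v ∈ F i := by simpa [hD] using hv
    simp only [c, dif_pos h]
    exact h.choose_spec
  have hmono : δ * Fintype.card V ≤
      ∑ e with ∃ i : Fin r, ∀ v ∈ e, c v = i, edgeWeight H e := by
    rw [sum_edgeWeight]
    have h := hrob c
    have hcard : Nat.card {e : Finset V // e ∈ H ∧ ∃ i : Fin r, ∀ v ∈ e, c v = i} =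
        (H.filter fun e => ∃ i : Fin r, ∀ v ∈ e, c v = i).card := by
      rw [Nat.card_eq_fintype_card]
      exact Fintype.card_of_subtype _ (by simp)
    rw [hcard] at h
    calc δ * Fintype.card V = δ * H.card * ((Fintype.card V : ℝ) / H.card) := by field_simp
      _ ≤ _ := by gcongr
  have hcover : ∑ e with ∃ i : Fin r, ∀ v ∈ e, c v = i, edgeWeight H e ≤
      ∑ i, ∑ e with e ⊆ F i, edgeWeight H e + ∑ v ∈ D, wdeg (edgeWeight H) {v} := by
    simp only [wdeg, Finset.sum_filter]
    rw [Finset.sum_comm, Finset.sum_comm (s := D), ← Finset.sum_add_distrib]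
    refine Finset.sum_le_sum fun e _ => ?_
    have h0 := hw.nonneg e
    have hnn : ∀ (p : Prop) [Decidable p], 0 ≤ if p then edgeWeight H e else 0 := fun p _ => by
      split_ifs <;> simp [h0]
    have hs1 : 0 ≤ ∑ i, if e ⊆ F i then edgeWeight H e else 0 :=
      Finset.sum_nonneg fun i _ => hnn _
    have hs2 : 0 ≤ ∑ v ∈ D, if {v} ⊆ e then edgeWeight H e else 0 :=
      Finset.sum_nonneg fun i _ => hnn _
    split_ifs with he
    · obtain ⟨i, hi⟩ := he
      by_cases hsub : e ⊆ F i
      · have := Finset.single_le_sum (f := fun i => if e ⊆ F i then edgeWeight H e else 0)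
          (fun i _ => hnn _) (Finset.mem_univ i)
        simp only [if_pos hsub] at this
        linarith
      · obtain ⟨v, hve, hvF⟩ := Finset.not_subset.1 hsub
        have hvD : v ∈ D := by
          by_contra hvD
          exact hvF (hi v hve ▸ hc v hvD)
        have := Finset.single_le_sum (f := fun v => if {v} ⊆ e then edgeWeight H e else 0)
          (fun i _ => hnn _) hvD
        simp only [if_pos (Finset.singleton_subset_iff.2 hve)] at this
        linarith
    · positivity
  have hcol : ∑ i, ∑ e with e ⊆ F i, edgeWeight H e ≤ r * (ε * Fintype.card V) := by
    calc _ ≤ ∑ _i : Fin r, ε * (Fintype.card V : ℝ) := Finset.sum_le_sum fun i _ => (hF i).le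
      _ = _ := by simp
  have hdeg : ∑ v ∈ D, wdeg (edgeWeight H) {v} ≤ K * D.card := by
    calc _ ≤ ∑ _v ∈ D, K := Finset.sum_le_sum fun v _ => by
            simpa using hw.wdeg_le {v} (Finset.singleton_nonempty v)
      _ = _ := by rw [Finset.sum_const, nsmul_eq_mul, mul_comm]
  linarith

end EdgeWeight

/-- **The 1-statement from robust non-colourability.** If `(𝓗_n)` is a
non-clustered, robustly non-`r`-colourable sequence of nonempty `s`-uniform
hypergraphs, then there are constants `C` and `α > 0` such that for all large
`n` and every `p ∈ [C·p_{𝓗_n}, 1]`, the probability that `𝓗_n[V_{p}]` is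
`r`-colourable is at most `exp(−α·p·v(𝓗_n))`. -/
theorem one_statement_robust (r s : ℕ) (hr : 2 ≤ r) (hs : 2 ≤ s)
    (V : ℕ → Type) [∀ n, Fintype (V n)] (H : ∀ n, Finset (Finset (V n)))
    (hne : ∀ n, (H n).Nonempty) (hunif : ∀ n, ∀ e ∈ H n, e.card = s)
    (hnc : NonClustered s V H) (hrob : RobustlyNonColourable r V H) :
    ∃ C α : ℝ, 0 < α ∧ ∀ᶠ n in atTop, ∀ p : ℝ, p ∈ Set.Icc (C * pH s (H n)) 1 →
      probSub (Finset.univ : Finset (V n)) p (fun Z => RColourable r (H n) Z) ≤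
        Real.exp (-(α * p * (Fintype.card (V n) : ℝ))) := by
  obtain ⟨⟨C₀, hC₀⟩, hnc⟩ := hnc
  obtain ⟨δ, hδ, hrob⟩ := hrob
  have : NeZero r := ⟨by omega⟩
  have hr0 : (0 : ℝ) < r := by exact_mod_cast (by omega : 0 < r)
  set K : ℝ := max C₀ 1
  have hK : 0 < K := lt_max_of_lt_right one_pos
  obtain ⟨b, q₀, m, hb, hq₀, hcont⟩ := exists_containers (k := s) (by omega) hK
    (show 0 < δ / (2 * r) by positivity)
  set γ : ℝ := δ / (2 * K)
  have hγ : 0 < γ := by positivity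
  set M : ℝ := 2 ^ Fintype.card (Fin r × Fin m)
  have hM : 0 < M := by positivity
  set Λ : ℝ := M * 4 / γ with hΛdef
  have hΛ : 0 < Λ := by positivity
  refine ⟨max (1 / q₀) (4 * Λ * (r * m) * b / γ), γ / 2, by positivity, ?_⟩
  have hdeg : ∀ᶠ n in atTop, ∀ t ∈ Finset.Icc 2 (s - 1), (maxDeg (H n) t : ℝ) ≤
      1 * pH s (H n) ^ (t - 1) * ((H n).card : ℝ) / (Fintype.card (V n) : ℝ) := by
    rw [Filter.eventually_all_finset]
    intro t ht
    rw [Finset.mem_Icc] at ht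
    exact hnc t ht.1 ht.2 1 one_pos
  filter_upwards [hdeg, hrob] with n hdeg hrob p hp
  obtain ⟨e₀, he₀⟩ := hne n
  have : Nonempty (V n) := by
    obtain ⟨v, -⟩ := Finset.card_pos.1 (by rw [hunif n e₀ he₀]; omega : 0 < e₀.card)
    exact ⟨v⟩
  set N : ℝ := (Fintype.card (V n) : ℝ) with hN
  have hN0 : 0 < N := by
    rw [hN]
    exact_mod_cast Fintype.card_pos
  have hH : (0 : ℝ) < (H n).card := by exact_mod_cast (hne n).card_pos
  set q := pH s (H n)
  have hq : 0 < q := Real.rpow_pos_of_pos (by positivity) _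
  have hqp₀ : 1 / q₀ * q ≤ p := le_trans (by gcongr; exact le_max_left _ _) hp.1
  have hqp : 4 * Λ * (r * m) * b / γ * q ≤ p := le_trans (by gcongr; exact le_max_right _ _) hp.1
  have hp0 : 0 < p := lt_of_lt_of_le (by positivity) hqp₀
  have hqle : q ≤ q₀ := by
    have := hqp₀.trans hp.2
    rwa [one_div_mul_eq_div, div_le_one hq₀] at this
  have hw : BoundedWeight s Finset.univ K q (edgeWeight (H n)) := by
    refine boundedWeight_edgeWeight hs (hne n) (hunif n) (le_max_right _ _) ?_ hdeg
    refine (hC₀ n).trans ?_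
    gcongr
    exact le_max_left _ _
  obtain ⟨F, hF⟩ := hcont (V n) q _ hq hqle hw
  have hprob := probSub_le_exp (ι := Fin r × Fin m) (B := r * m * (b * q * N)) (d := γ * N)
    (P := fun Z => RColourable r (H n) Z) hp0.le hp.2 hΛ.le
    (fun L => Finset.univ \ Finset.univ.biUnion fun i => F (List.ofFn fun j => L (i, j))) ?_
  · refine hprob.trans (Real.exp_le_exp.2 ?_)
    have h1 : Λ * (r * m * (b * q * N)) ≤ γ / 4 * (p * N) := by
      calc Λ * (r * m * (b * q * N)) = γ / 4 * (4 * Λ * (r * m) * b / γ * q * N) := by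
            field_simp
        _ ≤ γ / 4 * (p * N) := by gcongr
    have h2 : M * Real.exp (-Λ) * p * N ≤ γ / 4 * (p * N) := by
      have h3 : M * Real.exp (-Λ) ≤ γ / 4 := by
        rw [Real.exp_neg, ← div_eq_mul_inv, div_le_iff₀ (Real.exp_pos _)]
        calc M = γ / 4 * Λ := by
              rw [hΛdef]
              field_simp
          _ ≤ γ / 4 * Real.exp Λ := by
              gcongr
              linarith [Real.add_one_le_exp Λ]
      rw [mul_assoc]
      gcongr
    linarith
  · rintro Z ⟨c, hc⟩
    have hind : ∀ i, ∀ e ⊆ Z.filter fun v => c v = i, edgeWeight (H n) e = 0 := by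
      refine fun i e he => if_neg fun heH => hc e heH (he.trans (Finset.filter_subset _ _)) ⟨i, ?_⟩
      exact fun v hv => (Finset.mem_filter.1 (he hv)).2
    choose L hlen hL hsub hsmall using fun i => hF _ (hind i)
    let L' : Fin r × Fin m → Finset (V n) := fun x => (L x.1).get (x.2.cast (hlen x.1).symm)
    have hL' : ∀ i, (List.ofFn fun j => L' (i, j)) = L i := fun i => by
      refine List.ext_get (by simp [hlen]) fun j h1 h2 => ?_
      simp [L']
    have hfinger : ∀ x, IsFingerprint (b * q * N) (Z.filter fun v => c v = x.1) (L' x) :=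
      fun x => hL x.1 _ (List.get_mem _ _)
    refine ⟨Finset.univ.biUnion L', ?_, ?_, L', fun x => ?_, ?_, ?_⟩
    · exact Finset.biUnion_subset.2 fun x _ => (hfinger x).1.trans (Finset.filter_subset _ _)
    · calc ((Finset.univ.biUnion L').card : ℝ) ≤ ∑ x, ((L' x).card : ℝ) := by
            exact_mod_cast Finset.card_biUnion_le
        _ ≤ ∑ _x : Fin r × Fin m, b * q * N := Finset.sum_le_sum fun x _ => (hfinger x).2
        _ = r * m * (b * q * N) := by simp
    · exact Finset.subset_biUnion_of_mem L' (Finset.mem_univ x)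
    · simp only [hL']
      refine Finset.disjoint_left.2 fun v hv hvZ => (Finset.mem_sdiff.1 hv).2 ?_
      exact Finset.mem_biUnion.2 ⟨c v, Finset.mem_univ _, hsub (c v) (by simp [hvZ])⟩
    · simp only [hL']
      have h := le_card_compl_biUnion (hne n) hw hrob (fun i => F (L i)) hsmall
      have hδr : δ - r * (δ / (2 * r)) = δ / 2 := by
        field_simp
        norm_num
      rw [hδr] at h
      calc γ * N = δ / 2 * N / K := by
            simp only [γ]
            field_simp
        _ ≤ _ := by
            rw [div_le_iff₀ hK]
            linarith
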